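/- There exists a unique queenon γ* ∈ Γ that maximizes the Q-entropy: H_q(γ*) ≥ H_q(γ) for all γ ∈ Γ, and any γ ∈ Γ with H_q(γ) = H_q(γ*) equals γ*. -/

import Mathlib

open MeasureTheory Filter Topology
open scoped ENNReal

noncomputable section

/-- The square `[-1/2,1/2]²`. -/
def unitSq : Set (ℝ × ℝ) :=
  Set.Icc (-(1:ℝ)/2) (1/2) ×ˢ Set.Icc (-(1:ℝ)/2) (1/2)

/-- The square `σ_{i,j}^N` (for `i, j ∈ [N]`). -/
def gridSq (N i j : ℕ) : Set (ℝ × ℝ) :=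
  Set.Icc (-(1:ℝ)/2 + ((i:ℝ) - 1)/N) (-(1:ℝ)/2 + (i:ℝ)/N) ×ˢ
    Set.Icc (-(1:ℝ)/2 + ((j:ℝ) - 1)/N) (-(1:ℝ)/2 + (j:ℝ)/N)

/-- The cell of the partition `I_N` with index `i, j ∈ [2N]`. -/
def INcell (N i j : ℕ) : Set (ℝ × ℝ) :=
  {p ∈ unitSq | (-1 + ((i:ℝ) - 1)/N ≤ p.1 + p.2 ∧ p.1 + p.2 ≤ -1 + (i:ℝ)/N) ∧
    (-1 + ((j:ℝ) - 1)/N ≤ p.2 - p.1 ∧ p.2 - p.1 ≤ -1 + (j:ℝ)/N)}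

/-- The interval of the partition `J_N` of `[-1,1]` with index `i ∈ [2N]`. -/
def JNcell (N i : ℕ) : Set ℝ :=
  Set.Icc (-1 + ((i:ℝ) - 1)/N) (-1 + (i:ℝ)/N)

/-- A member of the family `R` of subsets of the square. -/
def Rset (a₁ b₁ a₂ b₂ : ℝ) : Set (ℝ × ℝ) :=
  {p ∈ unitSq | (a₁ ≤ p.1 + p.2 ∧ p.1 + p.2 ≤ b₁) ∧ (a₂ ≤ p.2 - p.1 ∧ p.2 - p.1 ≤ b₂)}

/-- The distance `d` between two Borel measures on the square: the supremum of
`|γ₁(α) − γ₂(α)|` over `α ∈ R`. -/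
def qdist (μ ν : Measure (ℝ × ℝ)) : ℝ :=
  sSup {t : ℝ | ∃ a₁ b₁ a₂ b₂ : ℝ, a₁ ∈ Set.Icc (-1:ℝ) 1 ∧ b₁ ∈ Set.Icc (-1:ℝ) 1 ∧
    a₂ ∈ Set.Icc (-1:ℝ) 1 ∧ b₂ ∈ Set.Icc (-1:ℝ) 1 ∧
    t = |(μ (Rset a₁ b₁ a₂ b₂)).toReal - (ν (Rset a₁ b₁ a₂ b₂)).toReal|}

/-- A permuton: a Borel probability measure on the square with uniform marginals. -/
def IsPermuton (μ : Measure (ℝ × ℝ)) : Prop :=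
  IsProbabilityMeasure μ ∧ μ unitSqᶜ = 0 ∧
  ∀ a b : ℝ, -(1:ℝ)/2 ≤ a → a ≤ b → b ≤ 1/2 →
    μ (Set.Icc a b ×ˢ Set.Icc (-(1:ℝ)/2) (1/2)) = ENNReal.ofReal (b - a) ∧
    μ (Set.Icc (-(1:ℝ)/2) (1/2) ×ˢ Set.Icc a b) = ENNReal.ofReal (b - a)

/-- An `N`-step permuton: a permuton with constant density on each square `σ_{i,j}^N`. -/
def IsStepPermutonN (N : ℕ) (μ : Measure (ℝ × ℝ)) : Prop :=
  IsPermuton μ ∧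
  ∀ i ∈ Finset.Icc 1 N, ∀ j ∈ Finset.Icc 1 N, ∃ c : ℝ≥0∞,
    ∀ s : Set (ℝ × ℝ), s ⊆ gridSq N i j → MeasurableSet s → μ s = c * volume s

/-- A step permuton. -/
def IsStepPermuton (μ : Measure (ℝ × ℝ)) : Prop :=
  ∃ N : ℕ, 0 < N ∧ IsStepPermutonN N μ

/-- Sub-uniform diagonal marginals. -/
def SubUniformDiag (μ : Measure (ℝ × ℝ)) : Prop :=
  ∀ a b : ℝ, -1 ≤ a → a ≤ b → b ≤ 1 →
    μ {p ∈ unitSq | a ≤ p.1 + p.2 ∧ p.1 + p.2 ≤ b} ≤ ENNReal.ofReal (b - a) ∧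
    μ {p ∈ unitSq | a ≤ p.2 - p.1 ∧ p.2 - p.1 ≤ b} ≤ ENNReal.ofReal (b - a)

/-- The set `Γ` of queenons: the closure, in the topology of weak convergence of Borel
probability measures, of the set of step permutons with sub-uniform diagonal marginals. -/
def queenons : Set (ProbabilityMeasure (ℝ × ℝ)) :=
  closure {μ : ProbabilityMeasure (ℝ × ℝ) |
    IsStepPermuton μ.toMeasure ∧ SubUniformDiag μ.toMeasure}

/-- The pushforward `γ⁺` of `γ` under `(x,y) ↦ x+y`. -/
def diagPlus (γ : Measure (ℝ × ℝ)) : Measure ℝ := γ.map fun p => p.1 + p.2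

/-- The pushforward `γ⁻` of `γ` under `(x,y) ↦ y−x`. -/
def diagMinus (γ : Measure (ℝ × ℝ)) : Measure ℝ := γ.map fun p => p.2 - p.1

/-- The measure `γ̄⁺` on `[-1,1]`, with `γ̄⁺([a,b]) = (b−a) − γ⁺([a,b])`. -/
def barPlus (γ : Measure (ℝ × ℝ)) : Measure ℝ :=
  volume.restrict (Set.Icc (-1:ℝ) 1) - diagPlus γ

/-- The measure `γ̄⁻` on `[-1,1]`, with `γ̄⁻([a,b]) = (b−a) − γ⁻([a,b])`. -/
def barMinus (γ : Measure (ℝ × ℝ)) : Measure ℝ :=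
  volume.restrict (Set.Icc (-1:ℝ) 1) - diagMinus γ

/-- The uniform probability measure on `[-1,1]` (density `1/2`). -/
def unif11 : Measure ℝ := (2 : ℝ≥0∞)⁻¹ • volume.restrict (Set.Icc (-1:ℝ) 1)

open Classical in
/-- The Kullback–Leibler divergence of `μ` with respect to `ν`, as an extended real:
`∫ log (dμ/dν) dμ` if `μ ≪ ν` and the integrand is integrable, and `+∞` otherwise. -/
def DKL {X : Type*} [MeasurableSpace X] (μ ν : Measure X) : EReal :=
  if μ ≪ ν ∧ Integrable (fun x => Real.log (μ.rnDeriv ν x).toReal) μ then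
    ((∫ x, Real.log (μ.rnDeriv ν x).toReal ∂μ : ℝ) : EReal)
  else ⊤

/-- The Q-entropy `H_q(γ) = −D_KL(γ) − D_KL(γ̄⁺) − D_KL(γ̄⁻) + 2 log 2 − 3`. -/
def Hq (γ : Measure (ℝ × ℝ)) : EReal :=
  -DKL γ (volume.restrict unitSq) - DKL (barPlus γ) unif11 - DKL (barMinus γ) unif11
    + ((2 * Real.log 2 - 3 : ℝ) : EReal)

/-- The discrete approximation `H_q^N` of the Q-entropy. -/
def HqN (N : ℕ) (γ : Measure (ℝ × ℝ)) : ℝ :=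
  -(∑ i ∈ Finset.Icc 1 (2*N), ∑ j ∈ Finset.Icc 1 (2*N),
      (γ (INcell N i j)).toReal *
        Real.log ((γ (INcell N i j)).toReal / (volume (INcell N i j)).toReal))
  - (∑ i ∈ Finset.Icc 1 (2*N),
      (barPlus γ (JNcell N i)).toReal *
        Real.log ((2*N : ℝ) * (barPlus γ (JNcell N i)).toReal))
  - (∑ i ∈ Finset.Icc 1 (2*N),
      (barMinus γ (JNcell N i)).toReal *
        Real.log ((2*N : ℝ) * (barMinus γ (JNcell N i)).toReal))
  + 2 * Real.log 2 - 3

/-- An `n`-queens configuration: a subset of `[n]² = {1,…,n}²` with exactly one element in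
each row and column and at most one element in each plus- and minus-diagonal. -/
def IsQueensConfig (n : ℕ) (q : Finset (ℕ × ℕ)) : Prop :=
  (∀ p ∈ q, p.1 ∈ Finset.Icc 1 n ∧ p.2 ∈ Finset.Icc 1 n) ∧
  (∀ y ∈ Finset.Icc 1 n, ∃! x : ℕ, (x, y) ∈ q) ∧
  (∀ x ∈ Finset.Icc 1 n, ∃! y : ℕ, (x, y) ∈ q) ∧
  (∀ p ∈ q, ∀ p' ∈ q, p.1 + p.2 = p'.1 + p'.2 → p = p') ∧
  (∀ p ∈ q, ∀ p' ∈ q, (p.2 : ℤ) - (p.1 : ℤ) = (p'.2 : ℤ) - (p'.1 : ℤ) → p = p')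

/-- `Q(n)`, the number of `n`-queens configurations. -/
def numQueens (n : ℕ) : ℕ :=
  Set.ncard {q : Finset (ℕ × ℕ) | IsQueensConfig n q}

/-- The measure `γ_q` associated to an `n`-queens configuration `q`: density `n` on each
square `σ_{i,j}^n` with `(i,j) ∈ q`, and `0` elsewhere. -/
def gammaOf (n : ℕ) (q : Finset (ℕ × ℕ)) : Measure (ℝ × ℝ) :=
  volume.withDensity ((⋃ ij ∈ q, gridSq n ij.1 ij.2).indicator fun _ => (n : ℝ≥0∞))

/-- The set `B_n(γ,ε)` of `n`-queens configurations `q` with `d(γ_q, γ) < ε`. -/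
def Bset (n : ℕ) (γ : Measure (ℝ × ℝ)) (ε : ℝ) : Set (Finset (ℕ × ℕ)) :=
  {q | IsQueensConfig n q ∧ qdist (gammaOf n q) γ < ε}

/-- `|B_n(γ,ε)|`. -/
def Bcard (n : ℕ) (γ : Measure (ℝ × ℝ)) (ε : ℝ) : ℕ := (Bset n γ ε).ncard

/-- The exponential of an extended real, with `exp(−∞) = 0`. -/
def expEReal (x : EReal) : ℝ := if x = ⊥ then 0 else Real.exp x.toReal

open InformationTheory in
/-- Quantitative midpoint convexity of `klFun`, in terms of the Hellinger distance. -/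
lemma klFun_midpoint_hellinger {a b : ℝ} (ha : 0 ≤ a) (hb : 0 ≤ b) :
    (√a - √b) ^ 2 / 2 + 2 * klFun ((a + b) / 2) ≤ klFun a + klFun b := by
  have key : ∀ x m : ℝ, 0 ≤ x → 0 < m →
      (√x - √m) ^ 2 ≤ x * Real.log x - x * Real.log m - x + m := by
    intro x m hx hm
    have hmm := Real.sq_sqrt hm.le
    rcases hx.eq_or_lt with rfl | hx
    · simp [hmm]
    have hxx := Real.sq_sqrt hx.le
    have hsx := Real.sqrt_pos.2 hx
    have hsm := Real.sqrt_pos.2 hm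
    have h := Real.log_le_sub_one_of_pos (div_pos hsm hsx)
    rw [Real.log_div hsm.ne' hsx.ne', Real.log_sqrt hm.le, Real.log_sqrt hx.le] at h
    have h2 : x * (√m / √x - 1) = √x * √m - x := by
      field_simp
      rw [← hxx]
      ring_nf
      rw [Real.sqrt_sq hsx.le]
      ring
    have h3 := mul_le_mul_of_nonneg_left h hx.le
    rw [h2] at h3
    nlinarith
  rcases (add_nonneg ha hb).eq_or_lt with h0 | hpos
  · have ha0 : a = 0 := by linarith
    have hb0 : b = 0 := by linarith
    subst ha0 hb0
    simp [klFun_zero]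
    norm_num
  have h1 := key a ((a + b) / 2) ha (by linarith)
  have h2 := key b ((a + b) / 2) hb (by linarith)
  have h3 : (√a - √b) ^ 2 / 2 ≤ (√a - √((a + b) / 2)) ^ 2 + (√b - √((a + b) / 2)) ^ 2 := by
    nlinarith [sq_nonneg (√a + √b - 2 * √((a + b) / 2))]
  simp only [klFun_apply]
  nlinarith

open InformationTheory in
/-- Quantitative midpoint convexity of `klFun`, in terms of the distance `|a - b|`. -/
lemma klFun_midpoint_abs {a b δ : ℝ} (ha : 0 ≤ a) (hb : 0 ≤ b) :
    δ * |a - b| + 2 * klFun ((a + b) / 2) ≤ klFun a + klFun b + δ ^ 2 * (a + b) := by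
  have h := klFun_midpoint_hellinger ha hb
  have haa := Real.sq_sqrt ha
  have hbb := Real.sq_sqrt hb
  have hab : |a - b| = |√a - √b| * (√a + √b) := by
    rw [← abs_of_nonneg (add_nonneg (Real.sqrt_nonneg a) (Real.sqrt_nonneg b)), ← abs_mul]
    congr 1
    linarith [sq_sub_sq (√a) (√b), mul_comm (√a - √b) (√a + √b)]
  have hsq : |√a - √b| ^ 2 = (√a - √b) ^ 2 := sq_abs _
  have h4 : (√a + √b) ^ 2 ≤ 2 * (a + b) := by nlinarith [sq_nonneg (√a - √b)]
  have h5 : δ * |a - b| ≤ (√a - √b) ^ 2 / 2 + δ ^ 2 * (√a + √b) ^ 2 / 2 := by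
    rw [hab, ← hsq]
    nlinarith [sq_nonneg (|√a - √b| - δ * (√a + √b))]
  nlinarith [mul_le_mul_of_nonneg_left h4 (sq_nonneg δ)]

/-- The average of two measures. -/
def measMid {X : Type*} [MeasurableSpace X] (μ μ' : Measure X) : Measure X :=
  (2 : ℝ≥0∞)⁻¹ • (μ + μ')

/-- The real-valued density of `μ` with respect to `ν`. -/
def density {X : Type*} [MeasurableSpace X] (μ ν : Measure X) (x : X) : ℝ :=
  (μ.rnDeriv ν x).toReal

section Abstract

variable {X : Type*} [MeasurableSpace X]

lemma measMid_apply (μ μ' : Measure X) (s : Set X) :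
    measMid μ μ' s = 2⁻¹ * (μ s + μ' s) := by
  simp [measMid, mul_add]

lemma half_mul_add_self (x : ℝ≥0∞) : 2⁻¹ * (x + x) = x := by
  rw [← two_mul, ← mul_assoc, ENNReal.inv_mul_cancel (by norm_num) (by norm_num), one_mul]

instance isProbabilityMeasure_measMid (μ μ' : Measure X) [IsProbabilityMeasure μ]
    [IsProbabilityMeasure μ'] : IsProbabilityMeasure (measMid μ μ') :=
  ⟨by rw [measMid_apply, measure_univ, measure_univ, half_mul_add_self]⟩

lemma measMid_absolutelyContinuous {μ μ' ν : Measure X} (h : μ ≪ ν) (h' : μ' ≪ ν) :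
    measMid μ μ' ≪ ν := by
  intro s hs
  rw [measMid_apply, h hs, h' hs]
  simp

lemma density_nonneg (μ ν : Measure X) (x : X) : 0 ≤ density μ ν x := ENNReal.toReal_nonneg

lemma measurable_density (μ ν : Measure X) : Measurable (density μ ν) :=
  (Measure.measurable_rnDeriv μ ν).ennreal_toReal

lemma integrable_density (μ ν : Measure X) [IsFiniteMeasure μ] :
    Integrable (density μ ν) ν := Measure.integrable_toReal_rnDeriv

lemma density_measMid (μ μ' ν : Measure X) [IsFiniteMeasure μ] [IsFiniteMeasure μ']
    [SigmaFinite ν] :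
    ∀ᵐ x ∂ν, density (measMid μ μ') ν x = (density μ ν x + density μ' ν x) / 2 := by
  filter_upwards [Measure.rnDeriv_smul_left_of_ne_top (μ + μ') ν
    (r := (2 : ℝ≥0∞)⁻¹) (by simp), Measure.rnDeriv_add μ μ' ν,
    Measure.rnDeriv_lt_top μ ν, Measure.rnDeriv_lt_top μ' ν] with x h1 h2 h3 h4
  simp only [density, measMid]
  rw [h1, Pi.smul_apply, h2, Pi.add_apply, smul_eq_mul, ENNReal.toReal_mul,
    ENNReal.toReal_add h3.ne h4.ne]
  simp
  ring

lemma lintegral_ofReal_density {μ ν : Measure X} [IsProbabilityMeasure μ] [SigmaFinite ν]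
    (h : μ ≪ ν) : ∫⁻ x, ENNReal.ofReal (density μ ν x) ∂ν = 1 := by
  rw [← measure_univ (μ := μ), ← Measure.lintegral_rnDeriv h]
  refine lintegral_congr_ae ?_
  filter_upwards [Measure.rnDeriv_lt_top μ ν] with x hx
  exact ENNReal.ofReal_toReal hx.ne

open InformationTheory in
lemma klDiv_eq_lintegral_density {μ ν : Measure X} [IsFiniteMeasure μ] [IsFiniteMeasure ν]
    (h : μ ≪ ν) : klDiv μ ν = ∫⁻ x, ENNReal.ofReal (klFun (density μ ν x)) ∂ν :=
  klDiv_eq_lintegral_klFun_of_ac h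

open InformationTheory in
/-- Quantitative midpoint convexity of the Kullback–Leibler divergence. -/
lemma klDiv_measMid_le {μ μ' ν : Measure X} [IsProbabilityMeasure μ] [IsProbabilityMeasure μ']
    [IsProbabilityMeasure ν] (h : μ ≪ ν) (h' : μ' ≪ ν) {δ : ℝ} (hδ : 0 ≤ δ) :
    ENNReal.ofReal δ * eLpNorm (density μ ν - density μ' ν) 1 ν + 2 * klDiv (measMid μ μ') ν ≤
      klDiv μ ν + klDiv μ' ν + 2 * ENNReal.ofReal (δ ^ 2) := by
  have m1 := measurable_density μ ν
  have m2 := measurable_density μ' ν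
  have m3 := measurable_density (measMid μ μ') ν
  have mk := measurable_klFun
  rw [klDiv_eq_lintegral_density h, klDiv_eq_lintegral_density h',
    klDiv_eq_lintegral_density (measMid_absolutelyContinuous h h'), eLpNorm_one_eq_lintegral_enorm,
    ← lintegral_const_mul _ (by fun_prop), ← lintegral_const_mul _ (by fun_prop),
    ← lintegral_add_left (by fun_prop), ← lintegral_add_left (by fun_prop), two_mul (ENNReal.ofReal _)]
  nth_rewrite 2 [← mul_one (ENNReal.ofReal (δ ^ 2))]
  nth_rewrite 1 [← mul_one (ENNReal.ofReal (δ ^ 2))]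
  nth_rewrite 1 [← lintegral_ofReal_density h]
  rw [← lintegral_ofReal_density h', ← lintegral_const_mul _ (by fun_prop),
    ← lintegral_const_mul _ (by fun_prop), ← lintegral_add_left (by fun_prop),
    ← lintegral_add_left (by fun_prop)]
  refine lintegral_mono_ae ?_
  filter_upwards [density_measMid μ μ' ν] with x hx
  have ha := density_nonneg μ ν x
  have hb := density_nonneg μ' ν x
  have hka := klFun_nonneg ha
  have hkb := klFun_nonneg hb
  have hkm : 0 ≤ klFun ((density μ ν x + density μ' ν x) / 2) := klFun_nonneg (by positivity)
  rw [hx, Pi.sub_apply, Real.enorm_eq_ofReal_abs, ← ENNReal.ofReal_ofNat 2, ← ENNReal.ofReal_mul hδ,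
    ← ENNReal.ofReal_mul (by norm_num), ← ENNReal.ofReal_mul (by positivity),
    ← ENNReal.ofReal_mul (by positivity), ← ENNReal.ofReal_add (by positivity) (by positivity),
    ← ENNReal.ofReal_add (by positivity) (by positivity),
    ← ENNReal.ofReal_add (by positivity) (by positivity),
    ← ENNReal.ofReal_add (by positivity) (by positivity)]
  apply ENNReal.ofReal_le_ofReal
  have := klFun_midpoint_abs (δ := δ) ha hb
  linarith

lemma eq_of_eLpNorm_density_eq_zero {μ μ' ν : Measure X} [IsFiniteMeasure μ] [IsFiniteMeasure μ']
    [SigmaFinite ν] (h : μ ≪ ν) (h' : μ' ≪ ν)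
    (h0 : eLpNorm (density μ ν - density μ' ν) 1 ν = 0) : μ = μ' := by
  rw [eLpNorm_eq_zero_iff (((measurable_density μ ν).sub
    (measurable_density μ' ν)).aestronglyMeasurable) one_ne_zero] at h0
  rw [← Measure.withDensity_rnDeriv_eq μ ν h, ← Measure.withDensity_rnDeriv_eq μ' ν h']
  refine withDensity_congr_ae ?_
  filter_upwards [h0, Measure.rnDeriv_lt_top μ ν, Measure.rnDeriv_lt_top μ' ν] with x hx h1 h2
  exact (ENNReal.toReal_eq_toReal_iff' h1.ne h2.ne).1 (sub_eq_zero.1 hx)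

open InformationTheory in
/-- A sequence of probability measures whose densities are rapidly Cauchy in `L¹` converges
setwise, and the Kullback–Leibler divergence is lower semicontinuous along it. -/
lemma exists_setwise_limit {ν : Measure X} [IsProbabilityMeasure ν] {μ : ℕ → Measure X}
    [∀ n, IsProbabilityMeasure (μ n)] (hac : ∀ n, μ n ≪ ν) {B : ℕ → ℝ≥0∞}
    (hB : ∑' i, B i ≠ ∞) (hcau : ∀ N n m : ℕ, N ≤ n → N ≤ m →
      eLpNorm (density (μ n) ν - density (μ m) ν) 1 ν < B N) :
    ∃ μlim : Measure X, IsProbabilityMeasure μlim ∧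
      klDiv μlim ν ≤ liminf (fun n => klDiv (μ n) ν) atTop ∧
      ∀ s, MeasurableSet s → Tendsto (fun n => μ n s) atTop (𝓝 (μlim s)) := by
  have hintg : ∀ n, Integrable (density (μ n) ν) ν := fun n => integrable_density _ _
  obtain ⟨f, hfm, hf⟩ := exists_stronglyMeasurable_limit_of_tendsto_ae
    (fun n => (hintg n).1) (Lp.ae_tendsto_of_cauchy_eLpNorm (fun n => (hintg n).1) le_rfl hB hcau)
  have hL1 := Lp.cauchy_tendsto_of_tendsto (fun n => (hintg n).1) f hB hcau hf
  have hfint : Integrable f ν := memLp_one_iff_integrable.1 <|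
    Lp.memLp_of_cauchy_tendsto le_rfl (fun n => memLp_one_iff_integrable.2 (hintg n)) f
      hfm.aestronglyMeasurable hL1
  have hf0 : ∀ᵐ x ∂ν, 0 ≤ f x := by
    filter_upwards [hf] with x hx
    exact ge_of_tendsto' hx fun n => density_nonneg _ _ _
  let μlim := ν.withDensity fun x => ENNReal.ofReal (f x)
  have hset : ∀ s, MeasurableSet s → Tendsto (fun n => μ n s) atTop (𝓝 (μlim s)) := by
    intro s hs
    have h := tendsto_setIntegral_of_L1' f hfm.aestronglyMeasurable (Eventually.of_forall hintg) hL1 s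
    have h1 : ∀ n, μ n s = ENNReal.ofReal (∫ x in s, density (μ n) ν x ∂ν) := by
      intro n
      simp only [density]
      rw [Measure.setIntegral_toReal_rnDeriv (hac n), Measure.real, ENNReal.ofReal_toReal
        (measure_ne_top _ _)]
    have h2 : μlim s = ENNReal.ofReal (∫ x in s, f x ∂ν) := by
      rw [withDensity_apply _ hs, ofReal_integral_eq_lintegral_ofReal hfint.integrableOn
        (ae_restrict_of_ae hf0)]
    simp_rw [h1, h2]
    exact (ENNReal.continuous_ofReal.tendsto _).comp h
  have hprob : IsProbabilityMeasure μlim :=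
    ⟨tendsto_nhds_unique (hset _ MeasurableSet.univ) (by simp)⟩
  refine ⟨μlim, hprob, ?_, hset⟩
  have hlim : ∀ᵐ x ∂ν, density μlim ν x = f x := by
    filter_upwards [Measure.rnDeriv_withDensity ν hfm.measurable.ennreal_ofReal, hf0] with x hx h0
    rw [density, hx, ENNReal.toReal_ofReal h0]
  rw [klDiv_eq_lintegral_density (withDensity_absolutelyContinuous _ _)]
  simp_rw [fun n => klDiv_eq_lintegral_density (hac n)]
  refine le_trans (lintegral_mono_ae ?_) (lintegral_liminf_le fun n =>
    (measurable_klFun.comp (measurable_density _ _)).ennreal_ofReal)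
  filter_upwards [hlim, hf] with x hx hfx
  rw [hx]
  exact (((ENNReal.continuous_ofReal.comp continuous_klFun).tendsto _).comp hfx).liminf_eq.ge

end Abstract

section Bar

/-- Lebesgue measure on `[-1,1]`. -/
def vol11 : Measure ℝ := volume.restrict (Set.Icc (-1:ℝ) 1)

lemma vol11_univ : vol11 Set.univ = 2 := by
  simp only [vol11, Measure.restrict_apply_univ, Real.volume_Icc]
  norm_num

instance isFiniteMeasure_vol11 : IsFiniteMeasure vol11 := ⟨by simp [vol11_univ]⟩

instance isProbabilityMeasure_unif11 : IsProbabilityMeasure unif11 :=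
  ⟨by
    change (2 : ℝ≥0∞)⁻¹ * vol11 Set.univ = 1
    rw [vol11_univ, ENNReal.inv_mul_cancel (by norm_num) (by norm_num)]⟩

variable {ρ ρ' : Measure ℝ} [IsProbabilityMeasure ρ] [IsProbabilityMeasure ρ']

lemma isProbabilityMeasure_vol11_sub (h : ρ ≤ vol11) : IsProbabilityMeasure (vol11 - ρ) :=
  ⟨by
    rw [Measure.sub_apply MeasurableSet.univ h, vol11_univ, measure_univ, ← one_add_one_eq_two,
      ENNReal.add_sub_cancel_right ENNReal.one_ne_top]⟩

lemma vol11_sub_absolutelyContinuous (ρ : Measure ℝ) : vol11 - ρ ≪ unif11 :=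
  (Measure.absolutelyContinuous_of_le Measure.sub_le).trans
    (Measure.AbsolutelyContinuous.rfl.smul_right (by simp))

lemma vol11_sub_measMid (h : ρ ≤ vol11) (h' : ρ' ≤ vol11) :
    vol11 - measMid ρ ρ' = measMid (vol11 - ρ) (vol11 - ρ') := by
  have key : measMid (vol11 - ρ) (vol11 - ρ') + measMid ρ ρ' = vol11 := by
    have h1 := Measure.sub_add_cancel_of_le h
    have h2 := Measure.sub_add_cancel_of_le h'
    ext s hs
    have e1 := congrArg (fun m : Measure ℝ => m s) h1
    have e2 := congrArg (fun m : Measure ℝ => m s) h2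
    simp only [Measure.add_apply] at e1 e2
    rw [Measure.add_apply, measMid_apply, measMid_apply, ← mul_add, add_add_add_comm, e1, e2,
      half_mul_add_self]
  nth_rewrite 1 [← key]
  exact Measure.add_sub_cancel

open InformationTheory in
lemma klDiv_vol11_sub_ne_top (h : ρ ≤ vol11) : klDiv (vol11 - ρ) unif11 ≠ ∞ := by
  have := isProbabilityMeasure_vol11_sub h
  rw [klDiv_eq_lintegral_density (vol11_sub_absolutelyContinuous ρ)]
  have hle : (2 : ℝ≥0∞)⁻¹ • (vol11 - ρ) ≤ unif11 := by
    intro s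
    change (2 : ℝ≥0∞)⁻¹ * (vol11 - ρ) s ≤ (2 : ℝ≥0∞)⁻¹ * vol11 s
    gcongr
    exact Measure.sub_le
  have hb : ∀ᵐ x ∂unif11, ENNReal.ofReal (klFun (density (vol11 - ρ) unif11 x)) ≤ 1 := by
    filter_upwards [Measure.rnDeriv_le_one_of_le hle, Measure.rnDeriv_smul_left_of_ne_top
      (vol11 - ρ) unif11 (r := (2 : ℝ≥0∞)⁻¹) (by simp)] with x h1 h2
    rw [h2, Pi.smul_apply, smul_eq_mul, Pi.one_apply] at h1
    have h3 : density (vol11 - ρ) unif11 x ≤ 2 := by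
      refine ENNReal.toReal_le_of_le_ofReal (by norm_num) ?_
      have := mul_le_mul_right h1 2
      rw [← mul_assoc, ENNReal.mul_inv_cancel (by norm_num) (by norm_num)] at this
      simpa using this
    have h0 := density_nonneg (vol11 - ρ) unif11 x
    rw [ENNReal.ofReal_le_one, klFun_apply]
    rcases h0.eq_or_lt with h0 | h0
    · simp [← h0]
    nlinarith [mul_le_mul_of_nonneg_left (Real.log_le_sub_one_of_pos h0) h0.le]
  refine ne_top_of_le_ne_top ENNReal.one_ne_top ((lintegral_mono_ae hb).trans ?_)
  simp

end Bar

section Queenons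

/-- A Borel measure on `ℝ` dominated by length on bounded open intervals is dominated by Lebesgue
measure. -/
lemma le_volume_of_Ioo {ρ : Measure ℝ}
    (h : ∀ a b, ρ (Set.Ioo a b) ≤ ENNReal.ofReal (b - a)) : ρ ≤ volume := by
  have hIoc : ∀ a b, ρ (Set.Ioc a b) ≤ ENNReal.ofReal (b - a) := by
    intro a b
    have ht : Tendsto (fun n : ℕ => ENNReal.ofReal (b + 1 / ((n : ℝ) + 1) - a)) atTop
        (𝓝 (ENNReal.ofReal (b + 0 - a))) :=
      (ENNReal.continuous_ofReal.tendsto _).comp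
        ((tendsto_const_nhds.add tendsto_one_div_add_atTop_nhds_zero_nat).sub tendsto_const_nhds)
    rw [add_zero] at ht
    refine ge_of_tendsto' ht fun n => (measure_mono ?_).trans (h _ _)
    intro x hx
    exact ⟨hx.1, hx.2.trans_lt (by linarith [Nat.one_div_pos_of_nat (α := ℝ) (n := n)])⟩
  rw [Real.volume_eq_stieltjes_id]
  refine Measure.le_iff.2 fun s hs => ?_
  rw [StieltjesFunction.measure_def]
  refine (OuterMeasure.le_ofFunction (m_empty := StieltjesFunction.id.length_empty)
    (μ := ρ.toOuterMeasure)).2 (fun t => ?_) s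
  rw [StieltjesFunction.length_eq]
  refine le_iInf₂ fun a b => le_iInf fun ht => (measure_mono ?_).trans (hIoc a b)
  rwa [show (botSet : Set ℝ) = ∅ from Set.eq_empty_of_forall_notMem fun x => not_isBot x,
    Set.sdiff_empty] at ht

/-- Measures supported on the unit square whose diagonal marginals are dominated by length. -/
def DiagBound (γ : Measure (ℝ × ℝ)) : Prop :=
  γ unitSqᶜ = 0 ∧ ∀ a b : ℝ,
    γ {p | p.1 + p.2 ∈ Set.Ioo a b} ≤ ENNReal.ofReal (b - a) ∧
    γ {p | p.2 - p.1 ∈ Set.Ioo a b} ≤ ENNReal.ofReal (b - a)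

lemma measurableSet_unitSq : MeasurableSet unitSq := measurableSet_Icc.prod measurableSet_Icc

lemma isClosed_setOf_measure_le {G : Set (ℝ × ℝ)} (hG : IsOpen G) (c : ℝ≥0∞) :
    IsClosed {γ : ProbabilityMeasure (ℝ × ℝ) | γ.toMeasure G ≤ c} := by
  rw [isClosed_iff_forall_filter]
  intro γ F hF hFs hFγ
  have h := ProbabilityMeasure.le_liminf_measure_open_of_tendsto (μs := id) (L := F) hFγ hG
  refine h.trans ?_
  refine (liminf_le_liminf (v := fun _ => c) (le_principal_iff.1 hFs)).trans ?_
  simp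

lemma measure_strip_le {γ : Measure (ℝ × ℝ)} {T : ℝ × ℝ → ℝ} (h0 : γ unitSqᶜ = 0)
    (hT : ∀ p ∈ unitSq, T p ∈ Set.Icc (-1 : ℝ) 1)
    (h : ∀ a b : ℝ, -1 ≤ a → a ≤ b → b ≤ 1 →
      γ {p ∈ unitSq | a ≤ T p ∧ T p ≤ b} ≤ ENNReal.ofReal (b - a)) (a b : ℝ) :
    γ {p | T p ∈ Set.Ioo a b} ≤ ENNReal.ofReal (b - a) := by
  have hsub : {p | T p ∈ Set.Ioo a b} ⊆
      {p ∈ unitSq | max a (-1) ≤ T p ∧ T p ≤ min b 1} ∪ unitSqᶜ := by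
    intro p hp
    by_cases hpu : p ∈ unitSq
    · exact Or.inl ⟨hpu, max_le hp.1.le (hT p hpu).1, le_min hp.2.le (hT p hpu).2⟩
    · exact Or.inr hpu
  refine (measure_mono hsub).trans ((measure_union_le _ _).trans ?_)
  rw [h0, add_zero]
  rcases le_or_gt (max a (-1)) (min b 1) with hab | hab
  · exact (h _ _ (le_max_right _ _) hab (min_le_right _ _)).trans
      (ENNReal.ofReal_le_ofReal (sub_le_sub (min_le_left _ _) (le_max_left _ _)))
  · have : {p ∈ unitSq | max a (-1) ≤ T p ∧ T p ≤ min b 1} = ∅ := by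
      ext p
      refine iff_of_false ?_ (Set.notMem_empty p)
      rintro ⟨-, h1, h2⟩
      exact absurd (h1.trans h2) hab.not_ge
    rw [this, measure_empty]
    exact zero_le

lemma add_mem_of_mem_unitSq {p : ℝ × ℝ} (hp : p ∈ unitSq) : p.1 + p.2 ∈ Set.Icc (-1 : ℝ) 1 := by
  obtain ⟨⟨h1, h2⟩, h3, h4⟩ := hp
  constructor <;> linarith

lemma sub_mem_of_mem_unitSq {p : ℝ × ℝ} (hp : p ∈ unitSq) : p.2 - p.1 ∈ Set.Icc (-1 : ℝ) 1 := by
  obtain ⟨⟨h1, h2⟩, h3, h4⟩ := hp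
  constructor <;> linarith

lemma diagBound_of_mem_queenons {γ : ProbabilityMeasure (ℝ × ℝ)} (hγ : γ ∈ queenons) :
    DiagBound γ.toMeasure := by
  have hcl : IsClosed {γ : ProbabilityMeasure (ℝ × ℝ) | DiagBound γ.toMeasure} := by
    have : {γ : ProbabilityMeasure (ℝ × ℝ) | DiagBound γ.toMeasure} =
        {γ | γ.toMeasure unitSqᶜ ≤ 0} ∩ ⋂ a : ℝ, ⋂ b : ℝ,
          ({γ | γ.toMeasure {p | p.1 + p.2 ∈ Set.Ioo a b} ≤ ENNReal.ofReal (b - a)} ∩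
          {γ | γ.toMeasure {p | p.2 - p.1 ∈ Set.Ioo a b} ≤ ENNReal.ofReal (b - a)}) := by
      ext γ
      simp [DiagBound]
    rw [this]
    refine (isClosed_setOf_measure_le (isClosed_Icc.prod isClosed_Icc).isOpen_compl 0).inter
      (isClosed_iInter fun a => isClosed_iInter fun b => ?_)
    exact (isClosed_setOf_measure_le (isOpen_Ioo.preimage (by fun_prop)) _).inter
      (isClosed_setOf_measure_le (isOpen_Ioo.preimage (by fun_prop)) _)
  refine closure_minimal ?_ hcl hγ
  rintro μ ⟨⟨N, -, ⟨-, h0, -⟩, -⟩, hsub⟩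
  refine ⟨h0, fun a b => ⟨?_, ?_⟩⟩
  · exact measure_strip_le h0 (fun _ => add_mem_of_mem_unitSq)
      (fun a b h1 h2 h3 => (hsub a b h1 h2 h3).1) a b
  · exact measure_strip_le h0 (fun _ => sub_mem_of_mem_unitSq)
      (fun a b h1 h2 h3 => (hsub a b h1 h2 h3).2) a b

lemma map_le_vol11 {γ : Measure (ℝ × ℝ)} {T : ℝ × ℝ → ℝ} (hTm : Measurable T)
    (h0 : γ unitSqᶜ = 0) (hT : ∀ p ∈ unitSq, T p ∈ Set.Icc (-1 : ℝ) 1)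
    (h : ∀ a b : ℝ, γ {p | T p ∈ Set.Ioo a b} ≤ ENNReal.ofReal (b - a)) :
    γ.map T ≤ vol11 := by
  have h1 : γ.map T ≤ volume := le_volume_of_Ioo fun a b => by
    rw [Measure.map_apply hTm measurableSet_Ioo]
    exact h a b
  have h2 : ∀ᵐ x ∂(γ.map T), x ∈ Set.Icc (-1 : ℝ) 1 := by
    refine (ae_map_iff hTm.aemeasurable measurableSet_Icc).2 ?_
    exact measure_mono_null (fun p hp hpu => hp (hT p hpu)) h0
  rw [← Measure.restrict_eq_self_of_ae_mem h2]
  exact Measure.restrict_mono le_rfl h1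

lemma DiagBound.diagPlus_le {γ : Measure (ℝ × ℝ)} (h : DiagBound γ) : diagPlus γ ≤ vol11 :=
  map_le_vol11 (by fun_prop) h.1 (fun _ => add_mem_of_mem_unitSq) fun a b => (h.2 a b).1

lemma DiagBound.diagMinus_le {γ : Measure (ℝ × ℝ)} (h : DiagBound γ) : diagMinus γ ≤ vol11 :=
  map_le_vol11 (by fun_prop) h.1 (fun _ => sub_mem_of_mem_unitSq) fun a b => (h.2 a b).2

instance isProbabilityMeasure_diagPlus (γ : Measure (ℝ × ℝ)) [IsProbabilityMeasure γ] :
    IsProbabilityMeasure (diagPlus γ) := Measure.isProbabilityMeasure_map (by fun_prop)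

instance isProbabilityMeasure_diagMinus (γ : Measure (ℝ × ℝ)) [IsProbabilityMeasure γ] :
    IsProbabilityMeasure (diagMinus γ) := Measure.isProbabilityMeasure_map (by fun_prop)

lemma map_measMid {X Y : Type*} [MeasurableSpace X] [MeasurableSpace Y] {T : X → Y}
    (hT : Measurable T) (μ μ' : Measure X) :
    (measMid μ μ').map T = measMid (μ.map T) (μ'.map T) := by
  simp only [measMid]
  rw [Measure.map_smul, Measure.map_add _ _ hT]

lemma gridSq_mul_subset {N M i j : ℕ} (hN : 0 < N) (hM : 0 < M) (hi : 1 ≤ i) (hj : 1 ≤ j) :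
    gridSq (N * M) i j ⊆ gridSq N ((i - 1) / M + 1) ((j - 1) / M + 1) := by
  have key : ∀ k : ℕ, 1 ≤ k →
      Set.Icc (-(1:ℝ)/2 + ((k:ℝ) - 1)/(N * M : ℕ)) (-(1:ℝ)/2 + (k:ℝ)/(N * M : ℕ)) ⊆
      Set.Icc (-(1:ℝ)/2 + ((((k - 1) / M + 1 : ℕ):ℝ) - 1)/N)
        (-(1:ℝ)/2 + (((k - 1) / M + 1 : ℕ):ℝ)/N) := by
    intro k hk
    have hN' : (0 : ℝ) < N := by exact_mod_cast hN
    have hM' : (0 : ℝ) < M := by exact_mod_cast hM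
    have h1 : ((k - 1) / M) * M + 1 ≤ k := by
      have := Nat.div_mul_le_self (k - 1) M
      omega
    have h2 : k ≤ ((k - 1) / M + 1) * M := by
      have := Nat.lt_div_mul_add (a := k - 1) hM
      rw [add_mul, one_mul]
      omega
    have h1' : ((((k - 1) / M : ℕ) : ℝ)) * M + 1 ≤ k := by exact_mod_cast h1
    have h2' : (k : ℝ) ≤ (((k - 1) / M : ℕ) + 1) * M := by exact_mod_cast h2
    refine Set.Icc_subset_Icc ?_ ?_
    · push_cast
      refine add_le_add le_rfl ?_
      rw [div_le_div_iff₀ hN' (by positivity)]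
      nlinarith
    · push_cast
      refine add_le_add le_rfl ?_
      rw [div_le_div_iff₀ (by positivity) hN']
      nlinarith
  exact Set.prod_mono (key i hi) (key j hj)

lemma IsStepPermutonN.mul_right {N M : ℕ} {μ : Measure (ℝ × ℝ)} (h : IsStepPermutonN N μ)
    (hN : 0 < N) (hM : 0 < M) : IsStepPermutonN (N * M) μ := by
  refine ⟨h.1, fun i hi j hj => ?_⟩
  rw [Finset.mem_Icc] at hi hj
  have hidx : ∀ k : ℕ, 1 ≤ k → k ≤ N * M → (k - 1) / M + 1 ∈ Finset.Icc 1 N := by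
    intro k h1 h2
    rw [Finset.mem_Icc]
    have : (k - 1) / M < N := (Nat.div_lt_iff_lt_mul hM).2 (by omega)
    exact ⟨Nat.le_add_left _ _, this⟩
  obtain ⟨c, hc⟩ := h.2 _ (hidx i hi.1 hi.2) _ (hidx j hj.1 hj.2)
  exact ⟨c, fun s hs => hc s (hs.trans (gridSq_mul_subset hN hM hi.1 hj.1))⟩

lemma IsStepPermutonN.measMid {N : ℕ} {μ μ' : Measure (ℝ × ℝ)} (h : IsStepPermutonN N μ)
    (h' : IsStepPermutonN N μ') : IsStepPermutonN N (measMid μ μ') := by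
  obtain ⟨⟨hp, h0, hm⟩, hs⟩ := h
  obtain ⟨⟨hp', h0', hm'⟩, hs'⟩ := h'
  refine ⟨⟨inferInstance, by simp [measMid_apply, h0, h0'], fun a b h1 h2 h3 => ?_⟩,
    fun i hi j hj => ?_⟩
  · simp only [measMid_apply]
    rw [(hm a b h1 h2 h3).1, (hm a b h1 h2 h3).2, (hm' a b h1 h2 h3).1, (hm' a b h1 h2 h3).2,
      half_mul_add_self]
    exact ⟨rfl, rfl⟩
  · obtain ⟨c, hc⟩ := hs i hi j hj
    obtain ⟨c', hc'⟩ := hs' i hi j hj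
    refine ⟨2⁻¹ * (c + c'), fun s h1 h2 => ?_⟩
    rw [measMid_apply, hc s h1 h2, hc' s h1 h2, ← add_mul, mul_assoc]

lemma SubUniformDiag.measMid {μ μ' : Measure (ℝ × ℝ)} (h : SubUniformDiag μ)
    (h' : SubUniformDiag μ') : SubUniformDiag (measMid μ μ') := by
  intro a b h1 h2 h3
  simp only [measMid_apply]
  rw [← half_mul_add_self (ENNReal.ofReal (b - a))]
  obtain ⟨hp, hm⟩ := h a b h1 h2 h3
  obtain ⟨hp', hm'⟩ := h' a b h1 h2 h3
  constructor <;> gcongr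

/-- The average of two probability measures. -/
def probMid (μ μ' : ProbabilityMeasure (ℝ × ℝ)) : ProbabilityMeasure (ℝ × ℝ) :=
  ⟨measMid μ.toMeasure μ'.toMeasure, inferInstance⟩

lemma continuous_probMid : Continuous (Function.uncurry probMid) := by
  rw [continuous_iff_continuousAt]
  rintro ⟨μ, μ'⟩
  rw [ContinuousAt, ProbabilityMeasure.tendsto_iff_forall_integral_tendsto]
  intro f
  have key : ∀ q : ProbabilityMeasure (ℝ × ℝ) × ProbabilityMeasure (ℝ × ℝ),
      ∫ x, f x ∂(Function.uncurry probMid q).toMeasure =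
        2⁻¹ * (∫ x, f x ∂q.1.toMeasure + ∫ x, f x ∂q.2.toMeasure) := by
    intro q
    change ∫ x, f x ∂(measMid q.1.toMeasure q.2.toMeasure) = _
    rw [measMid, integral_smul_measure, integral_add_measure (f.integrable _) (f.integrable _)]
    simp
  simp_rw [key]
  have h1 := ProbabilityMeasure.tendsto_iff_forall_integral_tendsto.1
    ((continuous_fst.tendsto (μ, μ'))) f
  have h2 := ProbabilityMeasure.tendsto_iff_forall_integral_tendsto.1
    ((continuous_snd.tendsto (μ, μ'))) f
  exact (h1.add h2).const_mul _

lemma probMid_mem_queenons {μ μ' : ProbabilityMeasure (ℝ × ℝ)} (h : μ ∈ queenons)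
    (h' : μ' ∈ queenons) : probMid μ μ' ∈ queenons := by
  refine map_mem_closure₂ continuous_probMid h h' ?_
  rintro ν ⟨⟨N, hN, hs⟩, hd⟩ ν' ⟨⟨N', hN', hs'⟩, hd'⟩
  refine ⟨⟨N * N', Nat.mul_pos hN hN', (hs.mul_right hN hN').measMid ?_⟩, hd.measMid hd'⟩
  rw [mul_comm]
  exact hs'.mul_right hN' hN

end Queenons

section Uniform

lemma isProbabilityMeasure_uniform : IsProbabilityMeasure (volume.restrict unitSq) :=
  ⟨by
    rw [Measure.restrict_apply_univ, unitSq, Measure.volume_eq_prod, Measure.prod_prod,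
      Real.volume_Icc]
    norm_num⟩

attribute [local instance] isProbabilityMeasure_uniform

/-- The volume of a diagonal strip of the unit square is at most its width. -/
lemma volume_strip_le {T : ℝ × ℝ → ℝ} (hT : Measurable T) {a b : ℝ}
    (h : ∀ x, volume {y | a ≤ T (x, y) ∧ T (x, y) ≤ b} ≤ ENNReal.ofReal (b - a)) :
    volume.restrict unitSq {p ∈ unitSq | a ≤ T p ∧ T p ≤ b} ≤ ENNReal.ofReal (b - a) := by
  have hm : MeasurableSet {p : ℝ × ℝ | a ≤ T p ∧ T p ≤ b} := hT measurableSet_Icc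
  have hp : (volume : Measure (ℝ × ℝ)).restrict unitSq =
      (volume.restrict (Set.Icc (-(1:ℝ)/2) (1/2))).prod
        (volume.restrict (Set.Icc (-(1:ℝ)/2) (1/2))) := by
    rw [Measure.prod_restrict, Measure.volume_eq_prod, unitSq]
  refine (measure_mono (t := {p | a ≤ T p ∧ T p ≤ b}) fun p hp => hp.2).trans ?_
  rw [hp, Measure.prod_apply hm]
  refine (lintegral_mono (g := fun _ => ENNReal.ofReal (b - a)) fun x => ?_).trans ?_
  · exact (Measure.restrict_apply_le _ _).trans (h x)
  · rw [lintegral_const, Measure.restrict_apply_univ, Real.volume_Icc]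
    norm_num

lemma subUniformDiag_uniform : SubUniformDiag (volume.restrict unitSq) := by
  intro a b _ _ _
  constructor
  · refine volume_strip_le (T := fun p => p.1 + p.2) (by fun_prop) fun x => ?_
    refine (measure_mono (t := Set.Icc (a - x) (b - x)) fun y hy => ?_).trans ?_
    · exact ⟨by linarith [hy.1], by linarith [hy.2]⟩
    · rw [Real.volume_Icc]
      exact ENNReal.ofReal_le_ofReal (by linarith)
  · refine volume_strip_le (T := fun p => p.2 - p.1) (by fun_prop) fun x => ?_
    refine (measure_mono (t := Set.Icc (a + x) (b + x)) fun y hy => ?_).trans ?_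
    · exact ⟨by linarith [hy.1], by linarith [hy.2]⟩
    · rw [Real.volume_Icc]
      exact ENNReal.ofReal_le_ofReal (by linarith)

lemma isStepPermutonN_uniform : IsStepPermutonN 1 (volume.restrict unitSq) := by
  refine ⟨⟨inferInstance, ?_, fun a b h1 h2 h3 => ?_⟩, fun i hi j hj => ⟨1, fun s hs hsm => ?_⟩⟩
  · rw [Measure.restrict_apply measurableSet_unitSq.compl]
    simp
  · have hsub : Set.Icc a b ⊆ Set.Icc (-(1:ℝ)/2) (1/2) := Set.Icc_subset_Icc h1 h3
    have hs₁ : Set.Icc a b ×ˢ Set.Icc (-(1:ℝ)/2) (1/2) ⊆ unitSq := Set.prod_mono hsub le_rfl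
    have hs₂ : Set.Icc (-(1:ℝ)/2) (1/2) ×ˢ Set.Icc a b ⊆ unitSq := Set.prod_mono le_rfl hsub
    constructor
    · rw [Measure.restrict_eq_self _ hs₁, Measure.volume_eq_prod,
        Measure.prod_prod, Real.volume_Icc, Real.volume_Icc]
      norm_num
    · rw [Measure.restrict_eq_self _ hs₂, Measure.volume_eq_prod,
        Measure.prod_prod, Real.volume_Icc, Real.volume_Icc]
      norm_num
  · simp only [Finset.Icc_self, Finset.mem_singleton] at hi hj
    subst hi hj
    rw [one_mul]
    refine Measure.restrict_eq_self _ (hs.trans (Set.prod_mono ?_ ?_)) <;>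
    exact Set.Icc_subset_Icc (by norm_num) (by norm_num)

/-- The uniform measure on the square, as a probability measure. -/
def uniformSq : ProbabilityMeasure (ℝ × ℝ) := ⟨volume.restrict unitSq, inferInstance⟩

lemma uniformSq_mem_queenons : uniformSq ∈ queenons :=
  subset_closure ⟨⟨1, one_pos, isStepPermutonN_uniform⟩, subUniformDiag_uniform⟩

end Uniform

section Entropy

attribute [local instance] isProbabilityMeasure_uniform

open InformationTheory

/-- The sum of the three divergences in the definition of the Q-entropy. -/
def queenDiv (γ : Measure (ℝ × ℝ)) : ℝ≥0∞ :=
  klDiv γ (volume.restrict unitSq) + klDiv (barPlus γ) unif11 + klDiv (barMinus γ) unif11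

lemma DKL_eq_klDiv {X : Type*} [MeasurableSpace X] (μ ν : Measure X) [IsProbabilityMeasure μ]
    [IsProbabilityMeasure ν] : DKL μ ν = (klDiv μ ν : EReal) := by
  rw [DKL]
  split_ifs with h
  · have h' : μ ≪ ν ∧ Integrable (llr μ ν) μ := h
    rw [← ENNReal.ofReal_toReal (klDiv_ne_top h'.1 h'.2), toReal_klDiv_of_measure_eq h'.1 (by simp),
      EReal.coe_ennreal_ofReal, max_eq_left]
    · rfl
    · rw [← toReal_klDiv_of_measure_eq h'.1 (by simp)]
      exact ENNReal.toReal_nonneg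
  · rw [klDiv_eq_top_iff.2 fun h1 h2 => h ⟨h1, h2⟩]
    rfl

variable {γ γ' : ProbabilityMeasure (ℝ × ℝ)}

lemma isProbabilityMeasure_barPlus (h : γ ∈ queenons) :
    IsProbabilityMeasure (barPlus γ.toMeasure) :=
  isProbabilityMeasure_vol11_sub (diagBound_of_mem_queenons h).diagPlus_le

lemma isProbabilityMeasure_barMinus (h : γ ∈ queenons) :
    IsProbabilityMeasure (barMinus γ.toMeasure) :=
  isProbabilityMeasure_vol11_sub (diagBound_of_mem_queenons h).diagMinus_le

lemma Hq_eq_neg_queenDiv (h : γ ∈ queenons) :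
    Hq γ.toMeasure = -(queenDiv γ.toMeasure : EReal) + ((2 * Real.log 2 - 3 : ℝ) : EReal) := by
  have := isProbabilityMeasure_barPlus h
  have := isProbabilityMeasure_barMinus h
  rw [Hq, DKL_eq_klDiv, DKL_eq_klDiv, DKL_eq_klDiv, queenDiv, EReal.coe_ennreal_add,
    EReal.neg_add (.inl (EReal.coe_ennreal_ne_bot _)) (.inr (EReal.coe_ennreal_ne_bot _)),
    EReal.coe_ennreal_add,
    EReal.neg_add (.inl (EReal.coe_ennreal_ne_bot _)) (.inr (EReal.coe_ennreal_ne_bot _))]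

lemma Hq_le_Hq_iff (h : γ ∈ queenons) (h' : γ' ∈ queenons) :
    Hq γ.toMeasure ≤ Hq γ'.toMeasure ↔ queenDiv γ'.toMeasure ≤ queenDiv γ.toMeasure := by
  rw [Hq_eq_neg_queenDiv h, Hq_eq_neg_queenDiv h',
    (EReal.addLECancellable_coe _).add_le_add_iff_right,
    EReal.neg_le_neg_iff, EReal.coe_ennreal_le_coe_ennreal_iff]

lemma queenDiv_uniformSq_ne_top : queenDiv uniformSq.toMeasure ≠ ∞ := by
  have h := diagBound_of_mem_queenons uniformSq_mem_queenons
  refine ENNReal.add_ne_top.2 ⟨ENNReal.add_ne_top.2 ⟨?_, klDiv_vol11_sub_ne_top h.diagPlus_le⟩,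
    klDiv_vol11_sub_ne_top h.diagMinus_le⟩
  change klDiv (volume.restrict unitSq) (volume.restrict unitSq) ≠ ∞
  simp [klDiv_self]

lemma absolutelyContinuous_of_queenDiv_ne_top {γ : Measure (ℝ × ℝ)} (h : queenDiv γ ≠ ∞) :
    γ ≪ volume.restrict unitSq :=
  (klDiv_ne_top_iff.1 (ENNReal.add_ne_top.1 (ENNReal.add_ne_top.1 h).1).1).1

/-- Two near-minimizers of `queenDiv` have nearby densities. -/
lemma eLpNorm_density_le_of_near_min {m : ℝ≥0∞} (hm : m ≠ ∞)
    (hmin : ∀ γ ∈ queenons, m ≤ queenDiv (γ : ProbabilityMeasure (ℝ × ℝ)).toMeasure)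
    (h : γ ∈ queenons) (h' : γ' ∈ queenons) {δ : ℝ} (hδ : 0 < δ)
    (hγ : queenDiv γ.toMeasure ≤ m + ENNReal.ofReal (δ ^ 2))
    (hγ' : queenDiv γ'.toMeasure ≤ m + ENNReal.ofReal (δ ^ 2)) :
    eLpNorm (density γ.toMeasure (volume.restrict unitSq) -
        density γ'.toMeasure (volume.restrict unitSq)) 1 (volume.restrict unitSq) +
      eLpNorm (density (barPlus γ.toMeasure) unif11 -
        density (barPlus γ'.toMeasure) unif11) 1 unif11 +
      eLpNorm (density (barMinus γ.toMeasure) unif11 -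
        density (barMinus γ'.toMeasure) unif11) 1 unif11 ≤ ENNReal.ofReal (8 * δ) := by
  have i1 := isProbabilityMeasure_barPlus h
  have i2 := isProbabilityMeasure_barMinus h
  have i3 := isProbabilityMeasure_barPlus h'
  have i4 := isProbabilityMeasure_barMinus h'
  have hfin : m + ENNReal.ofReal (δ ^ 2) ≠ ∞ := ENNReal.add_ne_top.2 ⟨hm, ENNReal.ofReal_ne_top⟩
  have k1 := klDiv_measMid_le
    (absolutelyContinuous_of_queenDiv_ne_top (ne_top_of_le_ne_top hfin hγ))
    (absolutelyContinuous_of_queenDiv_ne_top (ne_top_of_le_ne_top hfin hγ')) hδ.le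
  have k2 := klDiv_measMid_le (vol11_sub_absolutelyContinuous (diagPlus γ.toMeasure))
    (vol11_sub_absolutelyContinuous (diagPlus γ'.toMeasure)) hδ.le (μ := barPlus γ.toMeasure)
    (μ' := barPlus γ'.toMeasure)
  have k3 := klDiv_measMid_le (vol11_sub_absolutelyContinuous (diagMinus γ.toMeasure))
    (vol11_sub_absolutelyContinuous (diagMinus γ'.toMeasure)) hδ.le (μ := barMinus γ.toMeasure)
    (μ' := barMinus γ'.toMeasure)
  have hmid := hmin _ (probMid_mem_queenons h h')
  have hbp : barPlus (probMid γ γ').toMeasure =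
      measMid (barPlus γ.toMeasure) (barPlus γ'.toMeasure) := by
    change vol11 - (measMid γ.toMeasure γ'.toMeasure).map _ = _
    rw [map_measMid (by fun_prop)]
    exact vol11_sub_measMid (ρ := diagPlus γ.toMeasure) (ρ' := diagPlus γ'.toMeasure)
      (diagBound_of_mem_queenons h).diagPlus_le
      (diagBound_of_mem_queenons h').diagPlus_le
  have hbm : barMinus (probMid γ γ').toMeasure =
      measMid (barMinus γ.toMeasure) (barMinus γ'.toMeasure) := by
    change vol11 - (measMid γ.toMeasure γ'.toMeasure).map _ = _
    rw [map_measMid (by fun_prop)]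
    exact vol11_sub_measMid (ρ := diagMinus γ.toMeasure) (ρ' := diagMinus γ'.toMeasure)
      (diagBound_of_mem_queenons h).diagMinus_le
      (diagBound_of_mem_queenons h').diagMinus_le
  rw [queenDiv, hbp, hbm] at hmid
  change m ≤ klDiv (measMid γ.toMeasure γ'.toMeasure) _ + _ + _ at hmid
  rw [queenDiv] at hγ hγ'
  generalize eLpNorm (density γ.toMeasure _ - _) _ _ = e1 at *
  generalize eLpNorm (density (barPlus γ.toMeasure) _ - _) _ _ = e2 at *
  generalize eLpNorm (density (barMinus γ.toMeasure) _ - _) _ _ = e3 at *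
  set d := ENNReal.ofReal δ with hd
  have hd2 : ENNReal.ofReal (δ ^ 2) = d * d := by rw [sq, ENNReal.ofReal_mul hδ.le]
  have hd0 : d ≠ 0 := by simp [hd, hδ]
  have hdt : d ≠ ∞ := ENNReal.ofReal_ne_top
  have h8 : ENNReal.ofReal (8 * δ) = 8 * d := by
    rw [ENNReal.ofReal_mul (by norm_num)]
    norm_num [hd]
  rw [h8, ← ENNReal.mul_le_mul_iff_right hd0 hdt]
  rw [hd2] at hγ hγ' k1 k2 k3
  refine (ENNReal.add_le_add_iff_right (a := 2 * m) (ENNReal.mul_ne_top (by norm_num) hm)).1 ?_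
  calc d * (e1 + e2 + e3) + 2 * m
      ≤ d * (e1 + e2 + e3) +
        2 * (klDiv (measMid γ.toMeasure γ'.toMeasure) (volume.restrict unitSq) +
          klDiv (measMid (barPlus γ.toMeasure) (barPlus γ'.toMeasure)) unif11 +
          klDiv (measMid (barMinus γ.toMeasure) (barMinus γ'.toMeasure)) unif11) := by gcongr
    _ = (d * e1 + 2 * klDiv (measMid γ.toMeasure γ'.toMeasure) (volume.restrict unitSq)) +
        (d * e2 + 2 * klDiv (measMid (barPlus γ.toMeasure) (barPlus γ'.toMeasure)) unif11) +
        (d * e3 + 2 * klDiv (measMid (barMinus γ.toMeasure) (barMinus γ'.toMeasure)) unif11) := by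
      ring
    _ ≤ _ := add_le_add (add_le_add k1 k2) k3
    _ = (klDiv γ.toMeasure (volume.restrict unitSq) + klDiv (barPlus γ.toMeasure) unif11 +
          klDiv (barMinus γ.toMeasure) unif11) +
        (klDiv γ'.toMeasure (volume.restrict unitSq) + klDiv (barPlus γ'.toMeasure) unif11 +
          klDiv (barMinus γ'.toMeasure) unif11) + 6 * (d * d) := by ring
    _ ≤ (m + d * d) + (m + d * d) + 6 * (d * d) := add_le_add (add_le_add hγ hγ') le_rfl
    _ = d * (8 * d) + 2 * m := by ring

lemma vol11_sub_map_eq_of_tendsto {T : ℝ × ℝ → ℝ} (hT : Measurable T)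
    {γ : ℕ → Measure (ℝ × ℝ)} {γ' : Measure (ℝ × ℝ)} {ρ : Measure ℝ}
    [∀ n, IsFiniteMeasure (γ n)] [IsFiniteMeasure γ']
    (hγ : ∀ n, (γ n).map T ≤ vol11) (hγ' : γ'.map T ≤ vol11)
    (hlim : ∀ s, MeasurableSet s → Tendsto (fun n => γ n s) atTop (𝓝 (γ' s)))
    (hρ : ∀ s, MeasurableSet s → Tendsto (fun n => (vol11 - (γ n).map T) s) atTop (𝓝 (ρ s))) :
    vol11 - γ'.map T = ρ := by
  ext s hs
  refine tendsto_nhds_unique ?_ (hρ s hs)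
  simp_rw [fun n => Measure.sub_apply hs (hγ n), Measure.sub_apply hs hγ',
    Measure.map_apply hT hs]
  exact ENNReal.Tendsto.sub tendsto_const_nhds (hlim _ (hT hs)) (Or.inl (measure_ne_top _ _))

lemma liminf_add_liminf_le (u v : ℕ → ℝ≥0∞) :
    liminf u atTop + liminf v atTop ≤ liminf (fun n => u n + v n) atTop := by
  simp only [liminf_eq_iSup_iInf_of_nat]
  refine ENNReal.iSup_add_iSup_le fun i j => le_iSup_of_le (max i j) (le_iInf₂ fun k hk => ?_)
  exact add_le_add (iInf₂_le k ((le_max_left i j).trans hk))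
    (iInf₂_le k ((le_max_right i j).trans hk))

/-- The infimum of `queenDiv` over the queenons is attained. -/
lemma exists_isMin_queenDiv : ∃ γ ∈ queenons, ∀ γ' ∈ queenons,
    queenDiv (γ : ProbabilityMeasure (ℝ × ℝ)).toMeasure ≤
      queenDiv (γ' : ProbabilityMeasure (ℝ × ℝ)).toMeasure := by
  let m : ℝ≥0∞ := ⨅ γ ∈ queenons, queenDiv (γ : ProbabilityMeasure (ℝ × ℝ)).toMeasure
  have hmin : ∀ γ ∈ queenons, m ≤ queenDiv (γ : ProbabilityMeasure (ℝ × ℝ)).toMeasure :=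
    fun γ h => iInf₂_le γ h
  have hm : m ≠ ∞ := ne_top_of_le_ne_top queenDiv_uniformSq_ne_top (hmin _ uniformSq_mem_queenons)
  have hex : ∀ n : ℕ, ∃ γ ∈ queenons, queenDiv (γ : ProbabilityMeasure (ℝ × ℝ)).toMeasure <
      m + ENNReal.ofReal (((1 / 2 : ℝ) ^ n) ^ 2) := by
    intro n
    have : m < m + ENNReal.ofReal (((1 / 2 : ℝ) ^ n) ^ 2) :=
      ENNReal.lt_add_right hm (by simp)
    obtain ⟨γ, hγ⟩ := iInf_lt_iff.1 this
    obtain ⟨h, hγ⟩ := iInf_lt_iff.1 hγ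
    exact ⟨γ, h, hγ⟩
  choose γ hq hγ using hex
  have hcau := fun N n k (hn : N ≤ n) (hk : N ≤ k) => eLpNorm_density_le_of_near_min hm hmin
    (hq n) (hq k) (δ := (1 / 2 : ℝ) ^ N) (by positivity)
    ((hγ n).le.trans (by
      gcongr m + ENNReal.ofReal (?_ ^ 2)
      exact pow_le_pow_of_le_one (by norm_num) (by norm_num) hn))
    ((hγ k).le.trans (by
      gcongr m + ENNReal.ofReal (?_ ^ 2)
      exact pow_le_pow_of_le_one (by norm_num) (by norm_num) hk))
  have hlt : ∀ N : ℕ, ENNReal.ofReal (8 * (1 / 2 : ℝ) ^ N) < ENNReal.ofReal (9 * (1 / 2 : ℝ) ^ N) :=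
    fun N => (ENNReal.ofReal_lt_ofReal_iff (by positivity)).2
      (mul_lt_mul_of_pos_right (by norm_num) (by positivity))
  have hB : ∑' N : ℕ, ENNReal.ofReal (9 * (1 / 2 : ℝ) ^ N) ≠ ∞ := by
    rw [← ENNReal.ofReal_tsum_of_nonneg (fun n => by positivity)
      (summable_geometric_two.mul_left 9)]
    exact ENNReal.ofReal_ne_top
  have i1 := fun n => isProbabilityMeasure_barPlus (hq n)
  have i2 := fun n => isProbabilityMeasure_barMinus (hq n)
  obtain ⟨μ, hμ, hμkl, hμlim⟩ := exists_setwise_limit (μ := fun n => (γ n).toMeasure)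
    (fun n => absolutelyContinuous_of_queenDiv_ne_top (hγ n).ne_top) hB
    fun N n k hn hk => ((le_self_add.trans le_self_add).trans (hcau N n k hn hk)).trans_lt (hlt N)
  obtain ⟨ρ, hρ, hρkl, hρlim⟩ := exists_setwise_limit (μ := fun n => barPlus (γ n).toMeasure)
    (fun n => vol11_sub_absolutelyContinuous _) hB
    fun N n k hn hk => ((le_add_self.trans le_self_add).trans (hcau N n k hn hk)).trans_lt (hlt N)
  obtain ⟨τ, hτ, hτkl, hτlim⟩ := exists_setwise_limit (μ := fun n => barMinus (γ n).toMeasure)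
    (fun n => vol11_sub_absolutelyContinuous _) hB
    fun N n k hn hk => (le_add_self.trans (hcau N n k hn hk)).trans_lt (hlt N)
  let γlim : ProbabilityMeasure (ℝ × ℝ) := ⟨μ, hμ⟩
  have htend : Tendsto γ atTop (𝓝 γlim) :=
    tendsto_of_forall_isOpen_le_liminf' fun G hG => (hμlim G hG.measurableSet).liminf_eq.ge
  have hmem : γlim ∈ queenons := isClosed_closure.mem_of_tendsto htend (Eventually.of_forall hq)
  have hdb := fun n => diagBound_of_mem_queenons (hq n)
  have hp : barPlus μ = ρ := vol11_sub_map_eq_of_tendsto (by fun_prop)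
    (fun n => (hdb n).diagPlus_le) (diagBound_of_mem_queenons hmem).diagPlus_le hμlim hρlim
  have hn : barMinus μ = τ := vol11_sub_map_eq_of_tendsto (by fun_prop)
    (fun n => (hdb n).diagMinus_le) (diagBound_of_mem_queenons hmem).diagMinus_le hμlim hτlim
  refine ⟨γlim, hmem, fun γ' h' => le_trans ?_ (hmin γ' h')⟩
  have htm : Tendsto (fun n => queenDiv (γ n).toMeasure) atTop (𝓝 m) := by
    refine tendsto_of_tendsto_of_tendsto_of_le_of_le tendsto_const_nhds
      (h := fun n : ℕ => m + ENNReal.ofReal (((1 / 2 : ℝ) ^ n) ^ 2)) ?_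
      (fun n => hmin _ (hq n)) (fun n => (hγ n).le)
    have h0 : Tendsto (fun n : ℕ => ((1 / 2 : ℝ) ^ n) ^ 2) atTop (𝓝 (0 ^ 2)) :=
      (tendsto_pow_atTop_nhds_zero_of_lt_one (by norm_num) (by norm_num)).pow 2
    have := tendsto_const_nhds (x := m).add ((ENNReal.continuous_ofReal.tendsto _).comp h0)
    simpa using this
  rw [← htm.liminf_eq]
  change klDiv μ _ + klDiv (barPlus μ) _ + klDiv (barMinus μ) _ ≤ _
  rw [hp, hn]
  refine (add_le_add (add_le_add hμkl hρkl) hτkl).trans ?_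
  exact (add_le_add_left (liminf_add_liminf_le _ _) _).trans (liminf_add_liminf_le _ _)

end Entropy

/-- **Lemma (unique maximizer).**
There is a unique queenon `γ*` maximizing the Q-entropy `H_q` over `Γ`. -/
theorem Hq_unique_maximizer :
    ∃ γstar ∈ queenons,
      (∀ γ ∈ queenons, Hq (γ : ProbabilityMeasure (ℝ × ℝ)).toMeasure ≤
        Hq (γstar : ProbabilityMeasure (ℝ × ℝ)).toMeasure) ∧
      ∀ γ ∈ queenons, Hq (γ : ProbabilityMeasure (ℝ × ℝ)).toMeasure =
        Hq (γstar : ProbabilityMeasure (ℝ × ℝ)).toMeasure → γ = γstar := by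
  obtain ⟨γs, hs, hmin⟩ := exists_isMin_queenDiv
  refine ⟨γs, hs, fun γ h => (Hq_le_Hq_iff h hs).2 (hmin γ h), fun γ h heq => ?_⟩
  have hle := (Hq_le_Hq_iff hs h).1 heq.ge
  have hfin : queenDiv γs.toMeasure ≠ ∞ :=
    ne_top_of_le_ne_top queenDiv_uniformSq_ne_top (hmin _ uniformSq_mem_queenons)
  have := isProbabilityMeasure_uniform
  refine Subtype.ext (eq_of_eLpNorm_density_eq_zero (μ := γ.toMeasure) (μ' := γs.toMeasure)
    (ν := volume.restrict unitSq)
    (absolutelyContinuous_of_queenDiv_ne_top (ne_top_of_le_ne_top hfin hle))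
    (absolutelyContinuous_of_queenDiv_ne_top hfin) ?_)
  have hzero : Tendsto (fun n : ℕ => ENNReal.ofReal (8 * (1 / ((n : ℝ) + 1)))) atTop (𝓝 0) := by
    have := (ENNReal.continuous_ofReal.tendsto _).comp
      ((tendsto_one_div_add_atTop_nhds_zero_nat (𝕜 := ℝ)).const_mul 8)
    rwa [mul_zero, ENNReal.ofReal_zero] at this
  refine le_antisymm (ge_of_tendsto' hzero fun n => ?_) zero_le
  exact (le_self_add.trans le_self_add).trans (eLpNorm_density_le_of_near_min hfin hmin h hs
    (δ := 1 / ((n : ℝ) + 1)) (by positivity) (hle.trans le_self_add) le_self_add)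

end
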